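/- Let h be a Hessenberg function on {1,…,n} and s = diag(1, 0, …, 0). Then the ideal I_{s,h} is saturated with respect to the determinant: for every f ∈ R and every natural number m, if f · det(Z)^m ∈ I_{s,h} then f ∈ I_{s,h}. -/

import Mathlib

open MvPolynomial

noncomputable section

/-- The polynomial ring `R = ℂ[z_{ij} : 1 ≤ i,j ≤ n]` (indices 0-based). -/
abbrev R (n : ℕ) : Type := MvPolynomial (Fin n × Fin n) ℂ

/-- The ideal `L_i = ⟨z_{11}, …, z_{1i}⟩` (first row, first `i` variables; 0-based columns `j < i`).
    `Lideal n 0 = ⟨0⟩`. -/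
def Lideal (n : ℕ) [NeZero n] (i : ℕ) : Ideal (R n) :=
  Ideal.span { p | ∃ j : Fin n, (j : ℕ) < i ∧ p = X ((0 : Fin n), j) }

/-- The ideal `K_j`, generated by the `j × j` minors `p_B = det((z_{kℓ})_{k ∈ B, 1 ≤ ℓ ≤ j})`
    over all `j`-element subsets `B ⊆ {2, …, n}` (0-based: rows `B k ≠ 0`, columns `0,…,j-1`).
    For `j = n` (or `j > n`) there are no such subsets and the ideal is `⟨0⟩`. -/
def Kideal (n : ℕ) (j : ℕ) : Ideal (R n) :=
  Ideal.span { p | ∃ (hj : j ≤ n) (B : Fin j → Fin n), StrictMono B ∧ (∀ k, (B k : ℕ) ≠ 0) ∧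
    p = (Matrix.of fun k l : Fin j => (X (B k, Fin.castLE hj l) : R n)).det }

/-- A Hessenberg function (0-based): `h` is monotone with `h i ≥ i` for all `i`. -/
def IsHessenberg (n : ℕ) (h : Fin n → Fin n) : Prop := Monotone h ∧ ∀ i, i ≤ h i

/-- `i` is a corner of `h`, i.e. (1-based) `h(i) > h(i-1)` with the convention `h(0) = 0`;
    0-based, `i = 0` is always a corner. -/
def HessCorner (n : ℕ) (h : Fin n → Fin n) (i : Fin n) : Prop :=
  (i : ℕ) = 0 ∨ h ⟨(i : ℕ) - 1, lt_of_le_of_lt (Nat.sub_le _ _) i.isLt⟩ < h i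

/-- The `n × (i + h(i))` matrix with columns `x·v_1, …, x·v_i, v_1, …, v_{h(i)}`,
    where `v_j` is the `j`-th column of the generic matrix `Z`. Here (0-based) the paper's
    `i` is `a+1` and the paper's `h(i)` is `(h a) + 1`. -/
def hessMat (n : ℕ) (x : Matrix (Fin n) (Fin n) ℂ) (h : Fin n → Fin n) (a : Fin n) :
    Matrix (Fin n) (Fin ((a : ℕ) + 1) ⊕ Fin (((h a) : ℕ) + 1)) (R n) :=
  Matrix.of fun r c => Sum.elim
    (fun c' => ∑ k : Fin n, MvPolynomial.C (x r k) * X (k, Fin.castLE a.isLt c'))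
    (fun c' => X (r, Fin.castLE (h a).isLt c')) c

/-- The ideal `I_{x,h,i}` generated by all `(h(i)+1) × (h(i)+1)` minors of `hessMat`
    (paper's `h(i)+1` is `(h a) + 2` 0-based). -/
def hessIdealAt (n : ℕ) (x : Matrix (Fin n) (Fin n) ℂ) (h : Fin n → Fin n) (a : Fin n) :
    Ideal (R n) :=
  Ideal.span { p | ∃ (f : Fin (((h a) : ℕ) + 2) → Fin n)
    (g : Fin (((h a) : ℕ) + 2) → Fin ((a : ℕ) + 1) ⊕ Fin (((h a) : ℕ) + 1)),
    p = ((hessMat n x h a).submatrix f g).det }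

/-- The ideal `I_{x,h} = Σ_{i=1}^n I_{x,h,i}`. -/
def hessIdeal (n : ℕ) (x : Matrix (Fin n) (Fin n) ℂ) (h : Fin n → Fin n) : Ideal (R n) :=
  ∑ a : Fin n, hessIdealAt n x h a

/-- The minimal semisimple element `s = diag(1, 0, …, 0)`. -/
def sMat (n : ℕ) [NeZero n] : Matrix (Fin n) (Fin n) ℂ :=
  Matrix.diagonal (fun i => if i = 0 then 1 else 0)

/-- The rank `r_{pq}(w)` of the top-left `(p+1) × (q+1)` (0-based) submatrix of the
    permutation matrix of `w`. -/
def rankpq (n : ℕ) (w : Equiv.Perm (Fin n)) (p q : Fin n) : ℕ :=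
  (Finset.univ.filter fun j : Fin n => j ≤ q ∧ w j ≤ p).card

/-- The Schubert determinantal ideal `I_w`: generated, over all `p, q`, by the minors of size
    `1 + r_{pq}(w)` of the top-left `(p+1) × (q+1)` (0-based) submatrix of the generic matrix. -/
def schubertIdeal (n : ℕ) (w : Equiv.Perm (Fin n)) : Ideal (R n) :=
  Ideal.span { m | ∃ (p q : Fin n) (f g : Fin (rankpq n w p q + 1) → Fin n),
    (∀ k, f k ≤ p) ∧ (∀ k, g k ≤ q) ∧
    m = (Matrix.of fun k l => (X (f k, g l) : R n)).det }

/-- The generic matrix `Z`. -/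
def genZ (n : ℕ) : Matrix (Fin n) (Fin n) (R n) :=
  Matrix.of fun k l => X (k, l)

section WeightFiltration

variable {σ : Type*} (wt : (σ →₀ ℕ) →+ ℕ)

/-- The polynomials all of whose monomials have weight less than `w`. -/
def weightLT (w : ℕ) : Submodule ℂ (MvPolynomial σ ℂ) :=
  restrictSupport ℂ {d | wt d < w}

variable {wt}

theorem mem_weightLT {w : ℕ} {p : MvPolynomial σ ℂ} :
    p ∈ weightLT wt w ↔ ∀ d, w ≤ wt d → coeff d p = 0 := by
  rw [weightLT, mem_restrictSupport_iff]
  constructor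
  · intro h d hd
    by_contra hc
    exact absurd (h (mem_support_iff.2 hc)) (by simpa using hd)
  · intro h d hd
    by_contra hc
    exact mem_support_iff.1 hd (h d (by simpa using hc))

theorem weightLT_mono {v w : ℕ} (h : v ≤ w) : weightLT wt v ≤ weightLT wt w :=
  fun _ hp => mem_weightLT.2 fun d hd => mem_weightLT.1 hp d (h.trans hd)

theorem monomial_mem_weightLT {w : ℕ} {d : σ →₀ ℕ} (h : wt d < w) (c : ℂ) :
    monomial d c ∈ weightLT wt w := by
  classical
  refine mem_weightLT.2 fun d' hd' => ?_
  rw [coeff_monomial, if_neg]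
  rintro rfl
  omega

theorem mul_mem_weightLT {v w : ℕ} {p q : MvPolynomial σ ℂ} (hp : p ∈ weightLT wt (v + 1))
    (hq : q ∈ weightLT wt w) : p * q ∈ weightLT wt (v + w) := by
  classical
  refine mem_weightLT.2 fun d hd => ?_
  rw [coeff_mul]
  refine Finset.sum_eq_zero fun x hx => ?_
  replace hx := Finset.HasAntidiagonal.mem_antidiagonal.1 hx
  have hw : wt x.1 + wt x.2 = wt d := by rw [← map_add, hx]
  rcases le_or_gt (v + 1) (wt x.1) with h | h
  · rw [mem_weightLT.1 hp _ h, zero_mul]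
  · rw [mem_weightLT.1 hq _ (by omega), mul_zero]

variable (wt) in
/-- `p` is the monomial `d` plus terms of smaller weight. -/
def IsLeadOf (p : MvPolynomial σ ℂ) (d : σ →₀ ℕ) : Prop :=
  p - monomial d 1 ∈ weightLT wt (wt d)

theorem isLeadOf_monomial (d : σ →₀ ℕ) : IsLeadOf wt (monomial d 1) d := by
  simp [IsLeadOf]

theorem IsLeadOf.mem_weightLT {p : MvPolynomial σ ℂ} {d : σ →₀ ℕ} (h : IsLeadOf wt p d) :
    p ∈ weightLT wt (wt d + 1) := by
  have := add_mem (weightLT_mono (Nat.le_succ _) h)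
    (monomial_mem_weightLT (wt := wt) (Nat.lt_succ_self (wt d)) (1 : ℂ))
  simpa using this

theorem IsLeadOf.monomial_mul {p : MvPolynomial σ ℂ} {d : σ →₀ ℕ} (h : IsLeadOf wt p d)
    (u : σ →₀ ℕ) : IsLeadOf wt (monomial u 1 * p) (u + d) := by
  have := mul_mem_weightLT (monomial_mem_weightLT (wt := wt) (Nat.lt_succ_self (wt u)) (1 : ℂ)) h
  rwa [mul_sub, MvPolynomial.monomial_mul, one_mul, ← map_add] at this

/-- The top-weight monomials of a combination of polynomials with distinct leading monomials
are among these leading monomials. -/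
theorem mem_of_coeff_ne_zero {S : Set (σ →₀ ℕ)} {Φ : (σ →₀ ℕ) → MvPolynomial σ ℂ}
    (hΦ : ∀ d ∈ S, IsLeadOf wt (Φ d) d) {f : MvPolynomial σ ℂ}
    (hf : f ∈ Submodule.span ℂ (Φ '' S)) {d : σ →₀ ℕ} (hfd : f ∈ weightLT wt (wt d + 1))
    (hd : coeff d f ≠ 0) : d ∈ S := by
  classical
  obtain ⟨l, hl, rfl⟩ := (Finsupp.mem_span_image_iff_linearCombination ℂ).1 hf
  rw [Finsupp.mem_supported] at hl
  have key : ∀ x, (∀ y ∈ l.support, wt y ≤ wt x) →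
      coeff x (Finsupp.linearCombination ℂ Φ l) = l x := by
    intro x hx
    have h1 : Finsupp.linearCombination ℂ Φ l - ∑ y ∈ l.support, l y • monomial y (1 : ℂ) ∈
        weightLT wt (wt x) := by
      rw [Finsupp.linearCombination_apply, Finsupp.sum, ← Finset.sum_sub_distrib]
      refine Submodule.sum_mem _ fun y hy => ?_
      rw [← smul_sub]
      exact Submodule.smul_mem _ _ (weightLT_mono (hx y hy) (hΦ y (hl hy)))
    have h2 := mem_weightLT.1 h1 x le_rfl
    rw [coeff_sub, sub_eq_zero] at h2
    rw [h2, coeff_sum]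
    simp [coeff_smul, coeff_monomial]
    tauto
  have hne : l.support.Nonempty := by
    rw [Finset.nonempty_iff_ne_empty]
    intro h
    simp [Finsupp.support_eq_empty.1 h] at hd
  obtain ⟨x, hx, hmax⟩ := l.support.exists_max_image wt hne
  have hxd : wt x ≤ wt d := by
    by_contra hlt
    exact Finsupp.mem_support_iff.1 hx
      ((key x hmax).symm.trans (mem_weightLT.1 hfd x (by omega)))
  have h3 := key d fun y hy => (hmax y hy).trans hxd
  exact hl (Finsupp.mem_support_iff.2 (h3 ▸ hd))

/-- If the leading monomials of an ideal are known and form a set `S` with `d + e ∈ S → d ∈ S`,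
then a polynomial with leading monomial `e` is a nonzerodivisor modulo the ideal. -/
theorem mem_of_mul_mem_of_isLeadOf {S : Set (σ →₀ ℕ)} {Φ : (σ →₀ ℕ) → MvPolynomial σ ℂ}
    (hΦ : ∀ d ∈ S, IsLeadOf wt (Φ d) d) {J : Ideal (MvPolynomial σ ℂ)} (hJ : ∀ d ∈ S, Φ d ∈ J)
    (hspan : ∀ f ∈ J, f ∈ Submodule.span ℂ (Φ '' S)) {δ : MvPolynomial σ ℂ} {e : σ →₀ ℕ}
    (hδ : IsLeadOf wt δ e) (he : ∀ d, d + e ∈ S → d ∈ S) {f : MvPolynomial σ ℂ}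
    (hf : f * δ ∈ J) : f ∈ J := by
  classical
  obtain ⟨w, hw⟩ : ∃ w, f ∈ weightLT wt w :=
    ⟨f.support.sup wt + 1, mem_weightLT.2 fun d hd => by
      by_contra hc
      have := Finset.le_sup (f := wt) (mem_support_iff.2 hc)
      omega⟩
  induction w generalizing f with
  | zero =>
    have : f = 0 := MvPolynomial.ext _ _ fun d => mem_weightLT.1 hw d (Nat.zero_le _)
    rw [this]
    exact J.zero_mem
  | succ w ih =>
    have htop : ∀ d, wt d = w → coeff d f ≠ 0 → d ∈ S := by
      rintro d rfl hd
      have h1 : f * δ ∈ weightLT wt (wt (d + e) + 1) := by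
        rw [map_add, add_assoc]
        exact mul_mem_weightLT hw hδ.mem_weightLT
      have h2 : f * δ - f * monomial e 1 ∈ weightLT wt (wt (d + e)) := by
        rw [map_add, ← mul_sub]
        exact mul_mem_weightLT hw hδ
      have h3 := mem_weightLT.1 h2 _ le_rfl
      rw [coeff_sub, coeff_mul_monomial, mul_one, sub_eq_zero] at h3
      exact he d (mem_of_coeff_ne_zero hΦ (hspan _ hf) h1 (h3 ▸ hd))
    set T := f.support.filter fun d => wt d = w with hT
    have hTS : ∀ d ∈ T, d ∈ S := fun d hd => by
      rw [hT, Finset.mem_filter, mem_support_iff] at hd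
      exact htop d hd.2 hd.1
    set g := ∑ d ∈ T, coeff d f • Φ d with hg
    have hgJ : g ∈ J := J.sum_mem fun d hd => by
      rw [smul_eq_C_mul]
      exact J.mul_mem_left _ (hJ d (hTS d hd))
    have hlow : f - g ∈ weightLT wt w := by
      have h1 : g - ∑ d ∈ T, coeff d f • monomial d (1 : ℂ) ∈ weightLT wt w := by
        rw [hg, ← Finset.sum_sub_distrib]
        refine Submodule.sum_mem _ fun d hd => ?_
        rw [← smul_sub]
        have := hΦ d (hTS d hd)
        rw [IsLeadOf, (Finset.mem_filter.1 hd).2] at this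
        exact Submodule.smul_mem _ _ this
      have h2 : f - ∑ d ∈ T, coeff d f • monomial d (1 : ℂ) ∈ weightLT wt w := by
        refine mem_weightLT.2 fun d hd => ?_
        rw [coeff_sub, coeff_sum]
        simp only [coeff_smul, coeff_monomial, smul_eq_mul, mul_ite, mul_one, mul_zero,
          Finset.sum_ite_eq', hT, Finset.mem_filter, mem_support_iff]
        split_ifs with h
        · simp
        · rcases hd.eq_or_lt with h' | h'
          · have : coeff d f = 0 := by tauto
            simp [this]
          · simp [mem_weightLT.1 hw d h']
      simpa using sub_mem h2 h1
    have h4 : f - g ∈ J := ih (by rw [sub_mul]; exact sub_mem hf (J.mul_mem_right _ hgJ)) hlow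
    simpa using add_mem h4 hgJ

end WeightFiltration

section Minors

variable {n : ℕ}

/-- The exponent of `∏ i, z_{r i, c i}`. -/
def diagExp {k : ℕ} (r c : Fin k → Fin n) : Fin n × Fin n →₀ ℕ :=
  ∑ i, Finsupp.single (r i, c i) 1

theorem diagExp_apply_ne_zero {k : ℕ} {r c : Fin k → Fin n} {x : Fin n × Fin n} :
    diagExp r c x ≠ 0 ↔ ∃ i, (r i, c i) = x := by
  classical
  simp [diagExp, Finsupp.finsetSum_apply, Finsupp.single_apply]

/-- The weight of monomials for which `z_{rc}` has weight `ρ r * κ c`. -/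
def prodWeight (ρ κ : Fin n → ℕ) : (Fin n × Fin n →₀ ℕ) →+ ℕ :=
  Finsupp.weight fun x => ρ x.1 * κ x.2

theorem prodWeight_single (ρ κ : Fin n → ℕ) (x : Fin n × Fin n) :
    prodWeight ρ κ (Finsupp.single x 1) = ρ x.1 * κ x.2 := by
  simp [prodWeight, Finsupp.weight_single]

theorem prodWeight_diagExp (ρ κ : Fin n → ℕ) {k : ℕ} (r c : Fin k → Fin n) :
    prodWeight ρ κ (diagExp r c) = ∑ i, ρ (r i) * κ (c i) := by
  simp [diagExp, prodWeight_single]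

theorem isLeadOf_det {ρ κ : Fin n → ℕ} {k : ℕ} {r c : Fin k → Fin n} (hr : StrictMono (ρ ∘ r))
    (hc : StrictMono (κ ∘ c)) :
    IsLeadOf (prodWeight ρ κ) (Matrix.of fun i l => (X (r i, c l) : R n)).det (diagExp r c) := by
  classical
  have hX : ∀ τ : Equiv.Perm (Fin k),
      ∏ i, (X (r i, c (τ i)) : R n) = monomial (diagExp r (c ∘ τ)) 1 := fun τ => by
    rw [diagExp, monomial_sum_one]
    rfl
  have hdet : (Matrix.of fun i l => (X (r i, c l) : R n)).det =
      ∑ τ : Equiv.Perm (Fin k), Equiv.Perm.sign τ • (monomial (diagExp r (c ∘ τ)) 1 : R n) := by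
    rw [← Matrix.det_transpose, Matrix.det_apply]
    exact Finset.sum_congr rfl fun τ _ => by rw [← hX τ]; rfl
  rw [IsLeadOf, hdet, ← Finset.add_sum_erase _ _ (Finset.mem_univ 1), Equiv.Perm.sign_one,
    one_smul, Equiv.Perm.coe_one, Function.comp_id, add_sub_cancel_left]
  refine Submodule.sum_mem _ fun τ hτ => ?_
  have hmem : (monomial (diagExp r (c ∘ τ)) 1 : R n) ∈
      weightLT (prodWeight ρ κ) (prodWeight ρ κ (diagExp r c)) := by
    refine monomial_mem_weightLT ?_ _
    rw [prodWeight_diagExp, prodWeight_diagExp]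
    have hmono : Monovary (ρ ∘ r) (κ ∘ c) := hr.monotone.monovary hc.monotone
    refine (hmono.sum_mul_comp_perm_lt_sum_mul_iff (σ := τ)).2 fun h => ?_
    have hτm : Monotone τ := fun i l hil => by
      rcases hil.eq_or_lt with rfl | hlt
      · exact le_rfl
      · by_contra! hcon
        exact absurd (hr hlt) (not_lt.2 (h (hc hcon)))
    exact (Finset.mem_erase.1 hτ).1 (Tuple.unique_monotone (f := (id : Fin k → Fin k))
      (τ := 1) hτm monotone_id |> DFunLike.coe_injective)
  rcases Int.units_eq_one_or (Equiv.Perm.sign τ) with h | h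
  · simpa [h] using hmem
  · simpa [h] using hmem

variable {j : ℕ} (hj : j ≤ n)

/-- The minor of the rows `B` in the first `j` columns. -/
def rowMinor (B : Fin j → Fin n) : R n :=
  (Matrix.of fun k l => X (B k, Fin.castLE hj l)).det

/-- The rows of a generator of `Kideal`. -/
def IsLowerRows (B : Fin j → Fin n) : Prop :=
  StrictMono B ∧ ∀ k, (B k : ℕ) ≠ 0

theorem rowMinor_mem_Kideal {B : Fin j → Fin n} (hB : IsLowerRows B) :
    rowMinor hj B ∈ Kideal n j :=
  Ideal.subset_span ⟨hj, B, hB.1, hB.2, rfl⟩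

/-- Laplace expansion of a determinant in which the column `l` is repeated. -/
theorem sum_X_mul_rowMinor (C : Fin (j + 1) → Fin n) (l : Fin j) :
    ∑ p : Fin (j + 1), (-1) ^ ((p : ℕ) + l) * X (C p, Fin.castLE hj l) *
      rowMinor hj (C ∘ p.succAbove) = 0 := by
  have hzero : (Matrix.of fun p q : Fin (j + 1) =>
      (X (C p, Fin.castLE hj (l.predAbove q)) : R n)).det = 0 :=
    Matrix.det_zero_of_column_eq (i := l.castSucc) (j := l.succ) (Fin.castSucc_lt_succ).ne
      fun p => by simp
  rw [Matrix.det_succ_column _ l.castSucc] at hzero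
  rw [← hzero]
  refine Finset.sum_congr rfl fun p _ => ?_
  congr 1
  · simp
  · rw [rowMinor]
    congr 1
    ext1 a b
    simp [Fin.predAbove_succAbove]

section Exchange

variable {ρ κ : Fin n → ℕ} {C : Fin (j + 1) → Fin n} {l : Fin j}

theorem prodWeight_single_add_diagExp (p : Fin (j + 1)) :
    prodWeight ρ κ (Finsupp.single (C p, Fin.castLE hj l) 1 +
      diagExp (C ∘ p.succAbove) (Fin.castLE hj)) =
    ∑ i, (ρ ∘ C) i * (κ ∘ Fin.castLE hj ∘ l.predAbove)
      (((finSuccEquiv' p).trans (finSuccEquiv' l.castSucc).symm) i) := by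
  rw [map_add, prodWeight_single, prodWeight_diagExp, Fin.sum_univ_succAbove _ p]
  simp [Fin.predAbove_succAbove]

theorem monovary_predAbove (hκ : StrictMono (κ ∘ Fin.castLE hj)) (hC : StrictMono (ρ ∘ C)) :
    Monovary (ρ ∘ C) (κ ∘ Fin.castLE hj ∘ l.predAbove) :=
  hC.monotone.monovary (hκ.monotone.comp (Fin.predAbove_right_monotone l))

theorem prodWeight_exchange_le (hκ : StrictMono (κ ∘ Fin.castLE hj)) (hC : StrictMono (ρ ∘ C))
    (p : Fin (j + 1)) :
    prodWeight ρ κ (Finsupp.single (C p, Fin.castLE hj l) 1 +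
      diagExp (C ∘ p.succAbove) (Fin.castLE hj)) ≤
    prodWeight ρ κ (Finsupp.single (C l.castSucc, Fin.castLE hj l) 1 +
      diagExp (C ∘ l.castSucc.succAbove) (Fin.castLE hj)) := by
  rw [prodWeight_single_add_diagExp, prodWeight_single_add_diagExp]
  simpa using (monovary_predAbove hj hκ hC (l := l)).sum_mul_comp_perm_le_sum_mul
    (σ := (finSuccEquiv' p).trans (finSuccEquiv' l.castSucc).symm)

theorem prodWeight_exchange_lt (hκ : StrictMono (κ ∘ Fin.castLE hj)) (hC : StrictMono (ρ ∘ C))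
    {p : Fin (j + 1)} (hp : p < l.castSucc) :
    prodWeight ρ κ (Finsupp.single (C p, Fin.castLE hj l) 1 +
      diagExp (C ∘ p.succAbove) (Fin.castLE hj)) <
    prodWeight ρ κ (Finsupp.single (C l.castSucc, Fin.castLE hj l) 1 +
      diagExp (C ∘ l.castSucc.succAbove) (Fin.castLE hj)) := by
  rw [prodWeight_single_add_diagExp, prodWeight_single_add_diagExp]
  have := ((monovary_predAbove hj hκ hC (l := l)).sum_mul_comp_perm_lt_sum_mul_iff
    (σ := (finSuccEquiv' p).trans (finSuccEquiv' l.castSucc).symm)).2 ?_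
  · simpa using this
  intro h
  obtain ⟨i, hi⟩ := Fin.exists_succAbove_eq hp.ne'
  have hil : i < l := by
    have := congrArg Fin.val hi
    rw [Fin.succAbove_of_le_castSucc] at this
    · simp at this
      exact Fin.lt_def.2 (by omega)
    · by_contra! hlt
      rw [Fin.succAbove_of_castSucc_lt _ _ hlt] at hi
      exact absurd (hlt.trans hp) (hi ▸ lt_irrefl _)
  have := @h (p.succAbove i) p (by simpa [Fin.predAbove_succAbove] using hκ hil)
  exact absurd (hC (hi ▸ hp : p < p.succAbove i)) (not_lt.2 this)

end Exchange
section Straightening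

/-- `B` is a lower row set whose leading monomial divides `d`, with minimal sum of rows. -/
def IsMinRows (d : Fin n × Fin n →₀ ℕ) (B : Fin j → Fin n) : Prop :=
  IsLowerRows B ∧ diagExp B (Fin.castLE hj) ≤ d ∧
    ∀ B' : Fin j → Fin n, IsLowerRows B' → diagExp B' (Fin.castLE hj) ≤ d →
      ∑ k, (B k : ℕ) ≤ ∑ k, (B' k : ℕ)

theorem exists_isMinRows {d : Fin n × Fin n →₀ ℕ} {B : Fin j → Fin n} (hB : IsLowerRows B)
    (hd : diagExp B (Fin.castLE hj) ≤ d) : ∃ B', IsMinRows hj d B' := by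
  classical
  obtain ⟨B', hB', hmin⟩ := Finset.exists_min_image
    (Finset.univ.filter fun B : Fin j → Fin n => IsLowerRows B ∧ diagExp B (Fin.castLE hj) ≤ d)
    (fun B => ∑ k, (B k : ℕ)) ⟨B, by simp [hB, hd]⟩
  rw [Finset.mem_filter] at hB'
  exact ⟨B', hB'.2.1, hB'.2.2, fun B'' h h' => hmin B'' (by simp [h, h'])⟩

/-- If `B` does not have minimal sum of rows among the row sets with leading monomial dividing
`d`, then one of its rows can be lowered. -/
theorem exists_insert_row {d : Fin n × Fin n →₀ ℕ} {B B' : Fin j → Fin n} (hB : IsLowerRows B)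
    (hB' : IsMinRows hj d B') (hd : diagExp B (Fin.castLE hj) ≤ d) (hne : B ≠ B') :
    ∃ (C : Fin (j + 1) → Fin n) (l : Fin j), IsLowerRows C ∧
      C ∘ l.castSucc.succAbove = B ∧ d (C l.castSucc, Fin.castLE hj l) ≠ 0 ∧
      B l ≠ C l.castSucc := by
  classical
  have hex : ∃ l, B' l < B l := by
    by_contra! hcon
    have hle : ∀ k ∈ Finset.univ, (B k : ℕ) ≤ B' k := fun k _ => hcon k
    have heq := (Finset.sum_eq_sum_iff_of_le hle).1
      ((Finset.sum_le_sum hle).antisymm (hB'.2.2 B hB hd))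
    exact hne (funext fun k => Fin.ext (heq k (Finset.mem_univ k)))
  obtain ⟨l, hl, hmin⟩ := WellFounded.has_min (wellFounded_lt (α := Fin j)) {l | B' l < B l} hex
  have hl : B' l < B l := hl
  refine ⟨Fin.insertNth l.castSucc (B' l) B, l, ⟨?_, ?_⟩, ?_, ?_, ?_⟩
  · refine (Fin.strictMono_insertNth_iff _ _ _).2 ⟨hB.1, fun i hi => ?_, fun i hi => ?_⟩
    · have hi : i < l := hi
      exact (not_lt.1 fun h => hmin i h hi).trans_lt (hB'.1.1 hi)
    · have hi : l ≤ i := hi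
      exact hl.trans_le (hB.1.monotone hi)
  · intro k
    cases k using Fin.succAboveCases l.castSucc
    · simpa using hB'.1.2 l
    · simpa using hB.2 _
  · ext1 k
    simp
  · rw [Fin.insertNth_apply_same]
    have h1 : diagExp B' (Fin.castLE hj) (B' l, Fin.castLE hj l) ≠ 0 :=
      diagExp_apply_ne_zero.2 ⟨l, rfl⟩
    have h2 := hB'.2.1 (B' l, Fin.castLE hj l)
    omega
  · rw [Fin.insertNth_apply_same]
    exact hl.ne'

theorem IsLowerRows.strictMono_comp {k : ℕ} {B : Fin k → Fin n} (hB : IsLowerRows B)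
    {ρ : Fin n → ℕ} (hρ : ∀ r s : Fin n, (r : ℕ) ≠ 0 → r < s → ρ r < ρ s) : StrictMono (ρ ∘ B) :=
  fun i _ hil => hρ _ _ (hB.2 i) (hB.1 hil)

variable {a : ℕ} {ρ κ : Fin n → ℕ}

/-- `d` is divisible by one of the first `a` variables of the first row. -/
def HasRowVar [NeZero n] (a : ℕ) (d : Fin n × Fin n →₀ ℕ) : Prop :=
  ∃ c : Fin n, (c : ℕ) < a ∧ d (0, c) ≠ 0

variable [NeZero n]

/-- The leading monomials of `Lideal n a ⊔ Kideal n j`. -/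
def leadSet (a : ℕ) : Set (Fin n × Fin n →₀ ℕ) :=
  {d | HasRowVar a d ∨ ∃ B : Fin j → Fin n, IsLowerRows B ∧ diagExp B (Fin.castLE hj) ≤ d}

/-- Straightening: modulo monomials divisible by a first row variable, each multiple of a maximal
minor is a combination of standard multiples. -/
theorem monomial_mul_rowMinor_mem (hρ : ∀ r s : Fin n, (r : ℕ) ≠ 0 → r < s → ρ r < ρ s)
    (hκ : StrictMono (κ ∘ Fin.castLE hj)) {M : Submodule ℂ (R n)}
    (hrow : ∀ d, HasRowVar a d → monomial d 1 ∈ M)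
    (hmin : ∀ d, ¬ HasRowVar a d → ∀ B, IsLowerRows B → diagExp B (Fin.castLE hj) ≤ d →
      ∃ B', IsMinRows hj d B' ∧
        monomial (d - diagExp B' (Fin.castLE hj)) 1 * rowMinor hj B' ∈ M)
    (u : Fin n × Fin n →₀ ℕ) (B : Fin j → Fin n) (hB : IsLowerRows B) :
    monomial u 1 * rowMinor hj B ∈ M := by
  classical
  obtain ⟨N, hN⟩ : ∃ N : ℕ ×ₗ ℕ, N = toLex
    (prodWeight ρ κ (u + diagExp B (Fin.castLE hj)), ∑ k, (B k : ℕ)) := ⟨_, rfl⟩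
  induction N using WellFoundedLT.induction generalizing u B with
  | ind N ih =>
    by_cases hu : HasRowVar a (u + diagExp B (Fin.castLE hj))
    · obtain ⟨c, hca, hc⟩ := hu
      have hBc : diagExp B (Fin.castLE hj) (0, c) = 0 := by
        by_contra h
        obtain ⟨i, hi⟩ := diagExp_apply_ne_zero.1 h
        exact hB.2 i (by rw [(Prod.mk.inj hi).1]; simp)
      have huc : u (0, c) ≠ 0 := by simpa [hBc] using hc
      rw [as_sum (rowMinor hj B), Finset.mul_sum]
      refine Submodule.sum_mem _ fun v _ => ?_
      rw [monomial_mul, one_mul, ← mul_one (coeff v _), ← smul_eq_mul, ← smul_monomial]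
      exact Submodule.smul_mem _ _ (hrow _ ⟨c, hca, by simp [huc]⟩)
    obtain ⟨B', hB', hmem⟩ := hmin _ hu B hB le_add_self
    by_cases hBB : B = B'
    · subst hBB
      simpa using hmem
    obtain ⟨C, l, hC, rfl, hdC, hne⟩ := exists_insert_row hj hB hB' le_add_self hBB
    set q := l.castSucc with hq
    have hBx : diagExp (C ∘ q.succAbove) (Fin.castLE hj) (C q, Fin.castLE hj l) = 0 := by
      by_contra h
      obtain ⟨i, hi⟩ := diagExp_apply_ne_zero.1 h
      obtain ⟨h1, h2⟩ := Prod.mk.inj hi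
      exact absurd (hC.1.injective h1) (Fin.succAbove_ne _ _)
    obtain ⟨v, rfl⟩ : ∃ v, u = v + Finsupp.single (C q, Fin.castLE hj l) 1 := by
      have : Finsupp.single (C q, Fin.castLE hj l) 1 ≤ u := by
        rw [Finsupp.single_le_iff]
        have : u (C q, Fin.castLE hj l) ≠ 0 := by simpa [hBx] using hdC
        omega
      exact ⟨u - Finsupp.single (C q, Fin.castLE hj l) 1, (tsub_add_cancel_of_le this).symm⟩
    have hCρ := hC.strictMono_comp hρ
    have hrel := sum_X_mul_rowMinor hj C l
    rw [← Finset.add_sum_erase _ _ (Finset.mem_univ q), hq, Fin.val_castSucc,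
      (Even.add_self (l : ℕ)).neg_one_pow, one_mul, ← hq, add_eq_zero_iff_eq_neg] at hrel
    rw [monomial_add_single, pow_one, mul_assoc, hrel, mul_neg, Finset.mul_sum]
    refine Submodule.neg_mem _ (Submodule.sum_mem _ fun p hp => ?_)
    have hpq : p ≠ q := (Finset.mem_erase.1 hp).1
    have hCp : IsLowerRows (C ∘ p.succAbove) :=
      ⟨hC.1.comp (Fin.strictMono_succAbove p), fun k => hC.2 _⟩
    have hstep : monomial (v + Finsupp.single (C p, Fin.castLE hj l) 1) 1 *
        rowMinor hj (C ∘ p.succAbove) ∈ M := by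
      refine ih _ ?_ _ _ hCp rfl
      rw [hN, Prod.Lex.toLex_lt_toLex]
      have hsum : ∀ p, (C p : ℕ) + ∑ k, ((C ∘ p.succAbove) k : ℕ) = ∑ k, (C k : ℕ) := fun p =>
        (Fin.sum_univ_succAbove (fun k => (C k : ℕ)) p).symm
      rcases lt_or_gt_of_ne hpq with hlt | hgt
      · have := prodWeight_exchange_lt hj hκ hCρ hlt
        rw [← hq] at this
        left
        simp only [add_assoc, map_add] at this ⊢
        omega
      · have := prodWeight_exchange_le hj hκ hCρ (l := l) p
        rw [← hq] at this
        have h1 := hsum p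
        have h2 := hsum q
        have h3 : (C q : ℕ) < C p := hC.1 hgt
        simp only [add_assoc, map_add] at this ⊢
        rcases this.lt_or_eq with h | h
        · left
          omega
        · right
          constructor <;> omega
    rw [monomial_add_single, pow_one] at hstep
    rcases neg_one_pow_eq_or (R n) ((p : ℕ) + l) with h | h
    · rw [h, one_mul, ← mul_assoc]
      exact hstep
    · rw [h, neg_one_mul, neg_mul, mul_neg, ← mul_assoc]
      exact Submodule.neg_mem _ hstep

end Straightening

end Minors

section Saturation

variable {n : ℕ}

theorem mem_of_mem_ideal_span {σ : Type*} {S : Set (MvPolynomial σ ℂ)}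
    {M : Submodule ℂ (MvPolynomial σ ℂ)} (h : ∀ u, ∀ s ∈ S, monomial u 1 * s ∈ M)
    {f : MvPolynomial σ ℂ} (hf : f ∈ Ideal.span S) : f ∈ M := by
  refine Submodule.closure_induction (p := fun f _ => f ∈ M) M.zero_mem
    (fun _ _ _ _ => M.add_mem) (fun g s hs => ?_) hf
  rw [smul_eq_mul, as_sum g, Finset.sum_mul]
  refine M.sum_mem fun v _ => ?_
  have hv : monomial v (coeff v g) = coeff v g • monomial v (1 : ℂ) := by
    rw [smul_monomial, smul_eq_mul, mul_one]
  rw [hv, smul_mul_assoc]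
  exact M.smul_mem _ (h v s hs)

theorem StrictMono.val_add_le {j : ℕ} {B : Fin j → Fin n} (hB : StrictMono B) (k : Fin j) :
    (B k : ℕ) + j ≤ n + k := by
  have := Finset.card_le_card_of_injOn (s := Finset.Ici k) (t := Finset.Ici (B k)) B
    (fun i hi => by simpa using hB.monotone (by simpa using hi)) hB.injective.injOn
  rw [Fin.card_Ici, Fin.card_Ici] at this
  omega

theorem det_submatrix_genZ_mem {J : Ideal (R n)} {f : R n} (hf : f * (genZ n).det ∈ J)
    (r c : Equiv.Perm (Fin n)) :
    f * (Matrix.of fun i l => (X (r i, c l) : R n)).det ∈ J := by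
  have : (Matrix.of fun i l => (X (r i, c l) : R n)) =
      ((genZ n).submatrix r id).submatrix id c := rfl
  rw [this, Matrix.det_permute', Matrix.det_permute, mul_left_comm, mul_left_comm f]
  exact J.mul_mem_left _ (J.mul_mem_left _ hf)

variable [NeZero n]

theorem monomial_mem_Lideal {a : ℕ} {d : Fin n × Fin n →₀ ℕ} (hd : HasRowVar a d) :
    (monomial d 1 : R n) ∈ Lideal n a := by
  obtain ⟨c, hc, h⟩ := hd
  have hle : Finsupp.single ((0 : Fin n), c) 1 ≤ d := by
    rw [Finsupp.single_le_iff]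
    omega
  rw [← tsub_add_cancel_of_le hle, monomial_add_single, pow_one]
  exact Ideal.mul_mem_left _ _ (Ideal.subset_span ⟨c, hc, rfl⟩)

/-- The ideal `L_a + K_j` with `a < j` is saturated with respect to the determinant. -/
theorem mem_Lideal_sup_Kideal_of_mul_det_mem {a j : ℕ} (haj : a < j) (hj : j ≤ n) {f : R n}
    (hf : f * (genZ n).det ∈ Lideal n a ⊔ Kideal n j) : f ∈ Lideal n a ⊔ Kideal n j := by
  classical
  let ρ : Fin n → ℕ := fun r => if (r : ℕ) = 0 then n - 1 else r - 1
  let κ : Fin n → ℕ := fun c => if (c : ℕ) < j then n - j + c else c - j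
  let r : Fin n → Fin n := fun i =>
    ⟨if (i : ℕ) + 1 < n then i + 1 else 0, by have := i.2; split_ifs <;> omega⟩
  let c : Fin n → Fin n := fun i =>
    ⟨if (i : ℕ) + j < n then i + j else i + j - n, by have := i.2; split_ifs <;> omega⟩
  have hρ : ∀ r s : Fin n, (r : ℕ) ≠ 0 → r < s → ρ r < ρ s := fun r s hr hrs => by
    have : (r : ℕ) < s := hrs
    simp only [ρ]
    split_ifs <;> omega
  have hκ : StrictMono (κ ∘ Fin.castLE hj) := fun i l hil => by
    have : (i : ℕ) < l := hil
    simp [κ]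
    omega
  have hρr : ∀ i, ρ (r i) = i := fun i => by
    have := i.2
    by_cases h : (i : ℕ) + 1 < n
    · simp [ρ, r, h]
    · simp [ρ, r, h]
      omega
  have hκc : ∀ i, κ (c i) = i := fun i => by
    have := i.2
    by_cases h : (i : ℕ) + j < n
    · simp [κ, c, h]
    · have h' : (i : ℕ) + j - n < j := by omega
      simp [κ, c, h, h']
      omega
  have hrinj : Function.Injective r := fun i l h =>
    Fin.ext (by rw [← hρr i, ← hρr l, h])
  have hcinj : Function.Injective c := fun i l h =>
    Fin.ext (by rw [← hκc i, ← hκc l, h])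
  have hlead : IsLeadOf (prodWeight ρ κ) (Matrix.of fun i l => (X (r i, c l) : R n)).det
      (diagExp r c) :=
    isLeadOf_det (fun i l hil => by simpa [hρr] using hil) (fun i l hil => by simpa [hκc] using hil)
  have hf' := det_submatrix_genZ_mem hf
    (Equiv.ofBijective r (Finite.injective_iff_bijective.1 hrinj))
    (Equiv.ofBijective c (Finite.injective_iff_bijective.1 hcinj))
  simp only [Equiv.ofBijective_apply] at hf'
  have hrow : ∀ c' : Fin n, (c' : ℕ) < a → diagExp r c (0, c') = 0 := fun c' hc' => by
    by_contra h
    obtain ⟨i, hi⟩ := diagExp_apply_ne_zero.1 h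
    have h1 := congrArg (fun x => (x.1 : ℕ)) hi
    have h2 := congrArg (fun x => (x.2 : ℕ)) hi
    have := i.2
    simp only [r, c, Fin.val_zero] at h1 h2
    split_ifs at h1 h2 <;> omega
  have hdisj : ∀ B : Fin j → Fin n, IsLowerRows B → ∀ k,
      diagExp r c (B k, Fin.castLE hj k) = 0 := fun B hB k => by
    by_contra h
    obtain ⟨i, hi⟩ := diagExp_apply_ne_zero.1 h
    have h1 := congrArg (fun x => (x.1 : ℕ)) hi
    have h2 := congrArg (fun x => (x.2 : ℕ)) hi
    have h3 := hB.1.val_add_le k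
    have h4 := hB.2 k
    have := k.2
    have := i.2
    simp only [r, c, Fin.val_castLE] at h1 h2
    split_ifs at h1 h2 <;> omega
  have hex : ∀ d : Fin n × Fin n →₀ ℕ, ∃ p : R n, (HasRowVar a d → p = monomial d 1) ∧
      (¬ HasRowVar a d → ∀ B, IsLowerRows B → diagExp B (Fin.castLE hj) ≤ d →
        ∃ B', IsMinRows hj d B' ∧
          p = monomial (d - diagExp B' (Fin.castLE hj)) 1 * rowMinor hj B') := fun d => by
    by_cases hd : HasRowVar a d
    · exact ⟨_, fun _ => rfl, fun h => absurd hd h⟩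
    by_cases hB : ∃ B : Fin j → Fin n, IsLowerRows B ∧ diagExp B (Fin.castLE hj) ≤ d
    · obtain ⟨B, hB, hBd⟩ := hB
      obtain ⟨B', hB'⟩ := exists_isMinRows hj hB hBd
      exact ⟨_, fun h => absurd h hd, fun _ _ _ _ => ⟨B', hB', rfl⟩⟩
    · exact ⟨0, fun h => absurd h hd, fun _ B h h' => absurd ⟨B, h, h'⟩ hB⟩
  choose Φ hΦrow hΦmin using hex
  refine mem_of_mul_mem_of_isLeadOf (wt := prodWeight ρ κ) (S := leadSet hj a) (Φ := Φ)
    (fun d hd => ?_) (fun d hd => ?_) (fun g hg => ?_) hlead (fun d hd => ?_) hf'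
  · by_cases hr : HasRowVar a d
    · rw [hΦrow d hr]
      exact isLeadOf_monomial d
    · obtain ⟨B, hB, hBd⟩ := hd.resolve_left hr
      obtain ⟨B', hB', h⟩ := hΦmin d hr B hB hBd
      rw [h]
      have := (isLeadOf_det (hB'.1.strictMono_comp hρ) hκ).monomial_mul
        (d - diagExp B' (Fin.castLE hj))
      rwa [tsub_add_cancel_of_le hB'.2.1] at this
  · by_cases hr : HasRowVar a d
    · rw [hΦrow d hr]
      exact Ideal.mem_sup_left (monomial_mem_Lideal hr)
    · obtain ⟨B, hB, hBd⟩ := hd.resolve_left hr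
      obtain ⟨B', hB', h⟩ := hΦmin d hr B hB hBd
      rw [h]
      exact Ideal.mem_sup_right (Ideal.mul_mem_left _ _ (rowMinor_mem_Kideal hj hB'.1))
  · rw [Lideal, Kideal, ← Ideal.span_union] at hg
    have hrowM : ∀ d, HasRowVar a d → monomial d 1 ∈ Submodule.span ℂ (Φ '' leadSet hj a) :=
      fun d hd => Submodule.subset_span ⟨d, Or.inl hd, hΦrow d hd⟩
    refine mem_of_mem_ideal_span (fun u s hs => ?_) hg
    rcases hs with ⟨c', hc', rfl⟩ | ⟨_, B, hB, hB0, rfl⟩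
    · rw [← pow_one (X _), ← monomial_add_single]
      exact hrowM _ ⟨c', hc', by simp⟩
    · refine monomial_mul_rowMinor_mem hj hρ hκ hrowM (fun d hd B hB hBd => ?_) u B ⟨hB, hB0⟩
      obtain ⟨B', hB', h⟩ := hΦmin d hd B hB hBd
      exact ⟨B', hB', h ▸ Submodule.subset_span ⟨d, Or.inr ⟨B, hB, hBd⟩, rfl⟩⟩
  · rcases hd with ⟨c', hc', h⟩ | ⟨B, hB, hBd⟩
    · exact Or.inl ⟨c', hc', by simpa [hrow c' hc'] using h⟩
    · refine Or.inr ⟨B, hB, fun x => ?_⟩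
      by_cases hx : diagExp B (Fin.castLE hj) x = 0
      · rw [hx]
        exact Nat.zero_le _
      · obtain ⟨k, rfl⟩ := diagExp_apply_ne_zero.1 hx
        simpa [hdisj B hB k] using hBd (B k, Fin.castLE hj k)

end Saturation

section Decomposition

variable {n : ℕ}

/-- Any `j × j` determinant with rows avoiding the first one and columns among the first `j`
lies in `Kideal n j`. -/
theorem det_mem_Kideal {j : ℕ} (hj : j ≤ n) (B : Fin j → Fin n) (hB : ∀ k, (B k : ℕ) ≠ 0)
    (g : Fin j → Fin j) :
    (Matrix.of fun k l => (X (B k, Fin.castLE hj (g l)) : R n)).det ∈ Kideal n j := by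
  by_cases hg : Function.Injective g
  swap
  · simp only [Function.Injective, not_forall] at hg
    obtain ⟨a, b, hab, hne⟩ := hg
    rw [Matrix.det_zero_of_column_eq hne fun k => by simp [hab]]
    exact Ideal.zero_mem _
  by_cases hBi : Function.Injective B
  swap
  · simp only [Function.Injective, not_forall] at hBi
    obtain ⟨a, b, hab, hne⟩ := hBi
    rw [Matrix.det_zero_of_row_eq hne (by ext1 k; simp [hab])]
    exact Ideal.zero_mem _
  have hmono : StrictMono (B ∘ Tuple.sort B) :=
    (Tuple.monotone_sort B).strictMono_of_injective (hBi.comp (Tuple.sort B).injective)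
  have heq : (Matrix.of fun k l => (X (B k, Fin.castLE hj (g l)) : R n)) =
      ((Matrix.of fun k l => (X ((B ∘ Tuple.sort B) k, Fin.castLE hj l) : R n)).submatrix
        (Tuple.sort B).symm id).submatrix id
          (Equiv.ofBijective g (Finite.injective_iff_bijective.1 hg)) := by
    ext1 k l
    simp
  rw [heq, Matrix.det_permute', Matrix.det_permute]
  exact Ideal.mul_mem_left _ _ (Ideal.mul_mem_left _ _
    (rowMinor_mem_Kideal hj ⟨hmono, fun k => hB _⟩))

theorem Kideal_antitone : Antitone (Kideal n) := by
  refine antitone_nat_of_succ_le fun j => Ideal.span_le.2 ?_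
  rintro _ ⟨hj, B, hB, hB0, rfl⟩
  rw [SetLike.mem_coe, Matrix.det_succ_column _ (Fin.last j)]
  refine Ideal.sum_mem _ fun p _ => Ideal.mul_mem_left _ _ ?_
  have := rowMinor_mem_Kideal (Nat.le_of_succ_le hj) (B := B ∘ p.succAbove)
    ⟨hB.comp (Fin.strictMono_succAbove p), fun k => hB0 _⟩
  rw [rowMinor] at this
  convert this using 2
  ext1 k l
  simp

theorem hessIdealAt_le (x : Matrix (Fin n) (Fin n) ℂ) (h : Fin n → Fin n) (a : Fin n) :
    hessIdealAt n x h a ≤ hessIdeal n x h := by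
  rw [hessIdeal, Ideal.sum_eq_sup]
  exact Finset.le_sup (Finset.mem_univ a)

variable [NeZero n]

theorem Kideal_self : Kideal n n = ⊥ := by
  rw [Kideal, Ideal.span_eq_bot]
  rintro _ ⟨_, B, hB, hB0, -⟩
  obtain ⟨k, hk⟩ := Finite.injective_iff_surjective.1 hB.injective (0 : Fin n)
  exact absurd (by simp [hk]) (hB0 k)

theorem Lideal_mono : Monotone (Lideal n) := fun _ _ hab =>
  Ideal.span_mono fun _ ⟨c, hc, hp⟩ => ⟨c, hc.trans_le hab, hp⟩

theorem Lideal_zero : Lideal n 0 = ⊥ := by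
  rw [Lideal, Ideal.span_eq_bot]
  rintro _ ⟨c, hc, -⟩
  exact absurd hc (Nat.not_lt_zero _)

theorem hessMat_sMat_inl (h : Fin n → Fin n) (a r : Fin n) (c : Fin ((a : ℕ) + 1)) :
    hessMat n (sMat n) h a r (Sum.inl c) = if r = 0 then X (0, Fin.castLE a.isLt c) else 0 := by
  simp only [hessMat, sMat, Matrix.of_apply, Sum.elim_inl]
  rw [Finset.sum_eq_single r]
  · by_cases hr : r = 0 <;> simp [hr]
  · intro k _ hk
    simp [Matrix.diagonal_apply_ne _ hk.symm]
  · simp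

theorem hessIdealAt_sMat (h : Fin n → Fin n) (a : Fin n) :
    hessIdealAt n (sMat n) h a = Lideal n ((a : ℕ) + 1) * Kideal n ((h a : ℕ) + 1) := by
  apply le_antisymm
  · refine Ideal.span_le.2 ?_
    rintro _ ⟨f, g, rfl⟩
    by_cases hf : Function.Injective f
    swap
    · simp only [Function.Injective, not_forall] at hf
      obtain ⟨x, y, hxy, hne⟩ := hf
      rw [Matrix.det_zero_of_row_eq hne (by ext1 k; simp [hxy])]
      exact Ideal.zero_mem _
    by_cases hg : ∃ q c, g q = Sum.inl c
    swap
    · have hr : ∀ q, ∃ c, g q = Sum.inr c := fun q => by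
        rcases hq : g q with c | c
        · exact absurd ⟨q, c, hq⟩ hg
        · exact ⟨c, rfl⟩
      choose c hc using hr
      obtain ⟨x, y, hne, hxy⟩ := Fintype.exists_ne_map_eq_of_card_lt c (by simp)
      rw [Matrix.det_zero_of_column_eq hne fun k => by simp [hc, hxy]]
      exact Ideal.zero_mem _
    obtain ⟨q, c, hq⟩ := hg
    rw [SetLike.mem_coe, Matrix.det_succ_column _ q]
    refine Ideal.sum_mem _ fun p _ => ?_
    rw [mul_assoc]
    refine Ideal.mul_mem_left _ _ ?_
    rw [Matrix.submatrix_apply, hq, hessMat_sMat_inl]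
    split_ifs with hp
    swap
    · rw [zero_mul]
      exact Ideal.zero_mem _
    refine Ideal.mul_mem_mul (Ideal.subset_span ⟨_, by simp; omega, rfl⟩) ?_
    have hrows : ∀ k, f (p.succAbove k) ≠ 0 := fun k hk =>
      Fin.succAbove_ne p k (hf (hk.trans hp.symm))
    by_cases hg' : ∃ q' c', g (q.succAbove q') = Sum.inl c'
    · obtain ⟨q', c', hq'⟩ := hg'
      rw [Matrix.det_eq_zero_of_column_eq_zero q' fun k => by
        simp [hq', hessMat_sMat_inl, hrows]]
      exact Ideal.zero_mem _
    · have hr : ∀ k, ∃ c, g (q.succAbove k) = Sum.inr c := fun k => by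
        rcases hk : g (q.succAbove k) with c | c
        · exact absurd ⟨k, c, hk⟩ hg'
        · exact ⟨c, rfl⟩
      choose c' hc' using hr
      have := det_mem_Kideal (Nat.succ_le_of_lt (h a).isLt) (fun k => f (p.succAbove k))
        (fun k hk => hrows k (Fin.ext (by simpa using hk))) c'
      convert this using 2
      ext1 k l
      simp [hc', hessMat]
  · rw [Lideal, Kideal, Ideal.span_mul_span', Ideal.span_le]
    rintro _ ⟨_, ⟨c, hc, rfl⟩, _, ⟨hj, B, hB, hB0, rfl⟩, rfl⟩
    refine Ideal.subset_span ⟨Fin.cons 0 B, Fin.cons (Sum.inl ⟨c, hc⟩) Sum.inr, Eq.symm ?_⟩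
    rw [Matrix.det_succ_column_zero, Fin.sum_univ_succ, Finset.sum_eq_zero, add_zero]
    · simp [hessMat_sMat_inl]
      congr 1
    · intro k _
      have : B k ≠ 0 := fun hk => hB0 k (by simp [hk])
      simp [hessMat_sMat_inl, this]

/-- The generators of `Lideal n a` and `Kideal n j` involve disjoint sets of variables. -/
theorem Lideal_inf_Kideal_le_mul (a j : ℕ) :
    Lideal n a ⊓ Kideal n j ≤ Lideal n a * Kideal n j := by
  classical
  let π : R n →ₐ[ℂ] R n := aeval fun x => if x.1 = 0 ∧ (x.2 : ℕ) < a then 0 else X x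
  have hπ : ∀ f, f - π f ∈ Lideal n a := fun f => by
    rw [← Ideal.Quotient.eq]
    have : Ideal.Quotient.mkₐ ℂ (Lideal n a) = (Ideal.Quotient.mkₐ ℂ (Lideal n a)).comp π := by
      refine algHom_ext fun x => ?_
      simp only [AlgHom.comp_apply, π, aeval_X, Ideal.Quotient.mkₐ_eq_mk]
      split_ifs with hx
      · rw [map_zero, Ideal.Quotient.eq_zero_iff_mem]
        exact Ideal.subset_span ⟨x.2, hx.2, by rw [← hx.1]⟩
      · rfl
    exact DFunLike.congr_fun this f
  have hL : Lideal n a ≤ RingHom.ker π := Ideal.span_le.2 <| by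
    rintro _ ⟨c, hc, rfl⟩
    simp [RingHom.mem_ker, π, hc]
  have hK : ∀ f ∈ Kideal n j, f - π f ∈ Lideal n a * Kideal n j := fun f hf => by
    refine Submodule.span_induction (p := fun f _ => f - π f ∈ Lideal n a * Kideal n j)
      ?_ ?_ ?_ ?_ hf
    · rintro _ ⟨hj, B, hB, hB0, rfl⟩
      have : π (Matrix.of fun k l => (X (B k, Fin.castLE hj l) : R n)).det =
          (Matrix.of fun k l => (X (B k, Fin.castLE hj l) : R n)).det := by
        rw [AlgHom.map_det]
        congr 1
        ext1 k l
        have : B k ≠ 0 := fun hk => hB0 k (by simp [hk])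
        simp [π, this]
      rw [this, sub_self]
      exact Ideal.zero_mem _
    · simp
    · intro x y _ _ hx hy
      rw [map_add, add_sub_add_comm]
      exact add_mem hx hy
    · intro r x hx' hx
      have : r • x - π (r • x) = (r - π r) * x + π r * (x - π x) := by
        rw [smul_eq_mul, map_mul]
        ring
      rw [this]
      exact add_mem (Ideal.mul_mem_mul (hπ r) hx') (Ideal.mul_mem_left _ _ hx)
  intro f hf
  have h1 := hK f hf.2
  rwa [RingHom.mem_ker.1 (hL hf.1), sub_zero] at h1

/-- `I_{s,h}` is the intersection of the ideals `L_{i-1} + K_{h(i)}`. -/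
theorem mem_hessIdeal_sMat_iff {h : Fin n → Fin n} (hh : IsHessenberg n h) {f : R n} :
    f ∈ hessIdeal n (sMat n) h ↔ ∀ i : Fin n, f ∈ Lideal n i ⊔ Kideal n ((h i : ℕ) + 1) := by
  constructor
  · intro hf i
    suffices hle : hessIdeal n (sMat n) h ≤ Lideal n i ⊔ Kideal n ((h i : ℕ) + 1) from hle hf
    rw [hessIdeal, Ideal.sum_eq_sup]
    refine Finset.sup_le fun a _ => ?_
    rw [hessIdealAt_sMat]
    rcases lt_or_ge a i with hai | hia
    · have hL : Lideal n ((a : ℕ) + 1) ≤ Lideal n i := Lideal_mono (Nat.succ_le_of_lt hai)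
      exact Ideal.mul_le_left.trans (hL.trans le_sup_left)
    · have hK : Kideal n ((h a : ℕ) + 1) ≤ Kideal n ((h i : ℕ) + 1) :=
        Kideal_antitone (Nat.succ_le_succ (hh.1 hia))
      exact Ideal.mul_le_right.trans (hK.trans le_sup_right)
  · intro hf
    have key : ∀ t (ht : t < n), ∃ s k, f = s + k ∧ s ∈ hessIdeal n (sMat n) h ∧
        s ∈ Lideal n t ∧ k ∈ Kideal n ((h ⟨t, ht⟩ : ℕ) + 1) := by
      intro t
      induction t with
      | zero =>
        intro ht
        have := hf ⟨0, ht⟩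
        rw [Lideal_zero, bot_sup_eq] at this
        exact ⟨0, f, (zero_add f).symm, Ideal.zero_mem _, Ideal.zero_mem _, this⟩
      | succ t ih =>
        intro ht
        obtain ⟨s, k, hsk, hs, hsL, hk⟩ := ih (Nat.lt_of_succ_lt ht)
        obtain ⟨l, hl, k', hk', hlk⟩ := Submodule.mem_sup.1 (hf ⟨t + 1, ht⟩)
        have hle : (h ⟨t, Nat.lt_of_succ_lt ht⟩ : ℕ) ≤ h ⟨t + 1, ht⟩ :=
          hh.1 (Fin.mk_le_mk.2 (Nat.le_succ t))
        have hk'' : k' ∈ Kideal n ((h ⟨t, Nat.lt_of_succ_lt ht⟩ : ℕ) + 1) :=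
          Kideal_antitone (by omega) hk'
        have heq : k - k' = l - s := by linear_combination -hsk - hlk
        have hmem : k - k' ∈ hessIdeal n (sMat n) h := by
          refine hessIdealAt_le _ _ ⟨t, Nat.lt_of_succ_lt ht⟩ ?_
          rw [hessIdealAt_sMat]
          refine Lideal_inf_Kideal_le_mul _ _ ⟨?_, sub_mem hk hk''⟩
          rw [heq]
          exact sub_mem hl (Lideal_mono (Nat.le_succ t) hsL)
        refine ⟨s + (k - k'), k', by linear_combination hsk, add_mem hs hmem, ?_, hk'⟩
        rw [heq, add_sub_cancel]
        exact hl
    have hn : n - 1 < n := Nat.sub_lt (NeZero.pos n) one_pos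
    obtain ⟨s, k, rfl, hs, -, hk⟩ := key (n - 1) hn
    have hlast : (h ⟨n - 1, hn⟩ : ℕ) + 1 = n := by
      have h1 : n - 1 ≤ (h ⟨n - 1, hn⟩ : ℕ) := hh.2 ⟨n - 1, hn⟩
      have h2 := (h ⟨n - 1, hn⟩).isLt
      omega
    rw [hlast, Kideal_self, Ideal.mem_bot] at hk
    rwa [hk, add_zero]

end Decomposition

/-- Theorem 4.1, first equality of (4.1): `I_{s,h}` is saturated with
respect to the determinant of the generic matrix: `f · det(Z)^m ∈ I_{s,h}` implies
`f ∈ I_{s,h}`. -/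
theorem stmt17 (n : ℕ) [NeZero n] (h : Fin n → Fin n) (hh : IsHessenberg n h) :
    ∀ (f : R n) (m : ℕ), f * (genZ n).det ^ m ∈ hessIdeal n (sMat n) h →
      f ∈ hessIdeal n (sMat n) h := by
  intro f m hf
  rw [mem_hessIdeal_sMat_iff hh] at hf ⊢
  intro i
  have hi : (i : ℕ) ≤ h i := hh.2 i
  have hfi := hf i
  clear hf
  induction m with
  | zero => simpa using hfi
  | succ m ih =>
    rw [pow_succ, ← mul_assoc] at hfi
    exact ih (mem_Lideal_sup_Kideal_of_mul_det_mem (by omega) (Nat.succ_le_of_lt (h i).isLt) hfi)
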